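/- arXiv:2210.11157 — 4 statements merged into one kernel-verified Lean document; each statement's English description precedes it below -/
import Mathlib

section
/- With the notation of the context, the identity 2·S_{(3,0,0)} + 4·S_{(2,1,0)} + S_{(1,1,1)} = c₁³ + 2·c₁·c₂ − c₃ holds in R. -/
/-- The Schur element `S_σ = det (c_{σ_i + j − i})_{1 ≤ i,j ≤ k}` associated to a
partition `σ` (given as a function `Fin k → ℤ`) and a family `c : ℤ → R` of
"Chern elements". -/
def schurElement {R : Type*} [CommRing R] (c : ℤ → R) {k : ℕ} (σ : Fin k → ℤ) : R :=
  Matrix.det (Matrix.of fun i j : Fin k => c (σ i + (j : ℤ) - (i : ℤ)))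

/-- `2·S_{(3,0,0)} + 4·S_{(2,1,0)} + S_{(1,1,1)} = c₁³ + 2·c₁·c₂ − c₃`
for the Chern elements of a rank-4 bundle (so `c 0 = 1` and `c j = 0` for `j < 0`
or `j > 4`). -/
theorem schur_identity_one {R : Type*} [CommRing R] (c : ℤ → R)
    (hc0 : c 0 = 1) (hneg : ∀ j : ℤ, j < 0 → c j = 0) (hbig : ∀ j : ℤ, 4 < j → c j = 0) :
    2 * schurElement c ![3, 0, 0] + 4 * schurElement c ![2, 1, 0] +
      schurElement c ![1, 1, 1] = c 1 ^ 3 + 2 * c 1 * c 2 - c 3 := by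
  have hneg1 : c (-1) = 0 := hneg _ (by norm_num)
  have hneg2 : c (-2) = 0 := hneg _ (by norm_num)
  simp [schurElement, Matrix.det_fin_three, hc0, hneg1, hneg2]
  ring
end

section
/- With the notation of the context, the identity 6·S_{(3,1,0,0)} + 5·S_{(2,2,0,0)} + 6·S_{(2,1,1,0)} + S_{(1,1,1,1)} = c₁⁴ + 3·c₁²·c₂ − 3·c₁·c₃ − c₄ holds in R. -/
/-- `6·S_{(3,1,0,0)} + 5·S_{(2,2,0,0)} + 6·S_{(2,1,1,0)} + S_{(1,1,1,1)}
= c₁⁴ + 3·c₁²·c₂ − 3·c₁·c₃ − c₄` for the Chern elements of a rank-4 bundle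
(so `c 0 = 1` and `c j = 0` for `j < 0` or `j > 4`). -/
theorem schur_identity_two {R : Type*} [CommRing R] (c : ℤ → R)
    (hc0 : c 0 = 1) (hneg : ∀ j : ℤ, j < 0 → c j = 0) (hbig : ∀ j : ℤ, 4 < j → c j = 0) :
    6 * schurElement c ![3, 1, 0, 0] + 5 * schurElement c ![2, 2, 0, 0] +
      6 * schurElement c ![2, 1, 1, 0] + schurElement c ![1, 1, 1, 1] =
      c 1 ^ 4 + 3 * c 1 ^ 2 * c 2 - 3 * c 1 * c 3 - c 4 := by
  have hm1 : c (-1) = 0 := hneg _ (by norm_num)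
  have hm2 : c (-2) = 0 := hneg _ (by norm_num)
  have hm3 : c (-3) = 0 := hneg _ (by norm_num)
  have h5 : c 5 = 0 := hbig _ (by norm_num)
  have h6 : c 6 = 0 := hbig _ (by norm_num)
  simp [schurElement, Matrix.det_succ_row_zero, Fin.sum_univ_succ, Fin.succAbove, hc0, hm1, hm2,
    hm3, h5, h6]
  ring
end

section
/- With the notation of the context, the identity 2·S_{(2,2,0,0)} + 3·S_{(2,1,1,0)} + S_{(1,1,1,1)} = c₁⁴ − 3·c₁·c₃ + 2·c₄ holds in R. -/
/-- `2·S_{(2,2,0,0)} + 3·S_{(2,1,1,0)} + S_{(1,1,1,1)} = c₁⁴ − 3·c₁·c₃ + 2·c₄`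
for the Chern elements of a rank-4 bundle (so `c 0 = 1` and `c j = 0` for `j < 0`
or `j > 4`). -/
theorem schur_identity_four {R : Type*} [CommRing R] (c : ℤ → R)
    (hc0 : c 0 = 1) (hneg : ∀ j : ℤ, j < 0 → c j = 0) (hbig : ∀ j : ℤ, 4 < j → c j = 0) :
    2 * schurElement c ![2, 2, 0, 0] + 3 * schurElement c ![2, 1, 1, 0] +
      schurElement c ![1, 1, 1, 1] = c 1 ^ 4 - 3 * c 1 * c 3 + 2 * c 4 := by
  have h1 : c (-1) = 0 := hneg _ (by norm_num)
  have h2 : c (-2) = 0 := hneg _ (by norm_num)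
  have h3 : c (-3) = 0 := hneg _ (by norm_num)
  have h5 : c 5 = 0 := hbig _ (by norm_num)
  simp [schurElement, Matrix.det_succ_row_zero, Fin.sum_univ_succ, Fin.succAbove,
    hc0, h1, h2, h3, h5]
  ring
end

section
/- Let S₁ = {(2a(a³−3ab²+2b³), 3a⁴−4a³b+b⁴) : a, b ∈ ℝ, a > b ≥ 0}, S₂ = {(2b(2a³−3a²b+b³), a⁴−4ab³+3b⁴) : a, b ∈ ℝ, a > b ≥ 0}, and S₃ = {(10(a²b²(a−b)−a²c²(a−c)+b²c²(b−c)), 5(ab(a³−b³)−ac(a³−c³)+bc(b³−c³))) : a, b, c ∈ ℝ, a > b > c ≥ 0} be subsets of ℝ². Then the vector (1, 0) cannot be written as a finite linear combination with nonnegative real coefficients of elements of S₁ ∪ S₂ ∪ S₃; that is, (1,0) does not belong to the convex cone generated by S₁ ∪ S₂ ∪ S₃. -/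
open Finset in
/-- the vector `(1, 0) ∈ ℝ²` (the Schur coordinates of the second Chern
form of a rank-3 bundle) is not a finite nonnegative linear combination of elements of
the three generator families `S₁`, `S₂`, `S₃` of the Diverio–Fagioli cone. -/
theorem c2_not_in_cone
    (S₁ : Set (ℝ × ℝ))
    (hS₁ : S₁ = {p | ∃ a b : ℝ, a > b ∧ b ≥ 0 ∧
      p = (2 * a * (a ^ 3 - 3 * a * b ^ 2 + 2 * b ^ 3),
           3 * a ^ 4 - 4 * a ^ 3 * b + b ^ 4)})
    (S₂ : Set (ℝ × ℝ))
    (hS₂ : S₂ = {p | ∃ a b : ℝ, a > b ∧ b ≥ 0 ∧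
      p = (2 * b * (2 * a ^ 3 - 3 * a ^ 2 * b + b ^ 3),
           a ^ 4 - 4 * a * b ^ 3 + 3 * b ^ 4)})
    (S₃ : Set (ℝ × ℝ))
    (hS₃ : S₃ = {p | ∃ a b c : ℝ, a > b ∧ b > c ∧ c ≥ 0 ∧
      p = (10 * (a ^ 2 * b ^ 2 * (a - b) - a ^ 2 * c ^ 2 * (a - c) + b ^ 2 * c ^ 2 * (b - c)),
           5 * (a * b * (a ^ 3 - b ^ 3) - a * c * (a ^ 3 - c ^ 3) + b * c * (b ^ 3 - c ^ 3)))}) :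
    ¬ ∃ (n : ℕ) (t : Fin n → ℝ) (x : Fin n → ℝ × ℝ),
        (∀ i, 0 ≤ t i) ∧ (∀ i, x i ∈ S₁ ∪ S₂ ∪ S₃) ∧
        ∑ i, t i • x i = ((1 : ℝ), (0 : ℝ)) := by
  rintro ⟨n, t, x, ht, hx, hsum⟩
  have hpos : ∀ i, 0 < (x i).2 := by
    intro i
    rcases hx i with (h | h) | h
    · rw [hS₁] at h
      obtain ⟨a, b, hab, hb, h⟩ := h
      have hd : 0 < a - b := sub_pos.2 hab
      have ha : 0 < a := hb.trans_lt hab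
      rw [h, show 3 * a ^ 4 - 4 * a ^ 3 * b + b ^ 4
        = (a - b) ^ 2 * (3 * a ^ 2 + 2 * (a * b) + b ^ 2) by ring]
      positivity
    · rw [hS₂] at h
      obtain ⟨a, b, hab, hb, h⟩ := h
      have hd : 0 < a - b := sub_pos.2 hab
      have ha : 0 < a := hb.trans_lt hab
      rw [h, show a ^ 4 - 4 * a * b ^ 3 + 3 * b ^ 4
        = (a - b) ^ 2 * (a ^ 2 + 2 * (a * b) + 3 * b ^ 2) by ring]
      positivity
    · rw [hS₃] at h
      obtain ⟨a, b, c, hab, hbc, hc, h⟩ := h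
      have hab' : 0 < a - b := sub_pos.2 hab
      have hbc' : 0 < b - c := sub_pos.2 hbc
      have hac' : 0 < a - c := sub_pos.2 (hbc.trans hab)
      have hb : 0 < b := hc.trans_lt hbc
      have ha : 0 < a := hb.trans hab
      rw [h, show 5 * (a * b * (a ^ 3 - b ^ 3) - a * c * (a ^ 3 - c ^ 3) + b * c * (b ^ 3 - c ^ 3))
        = 5 * ((a - b) * (b - c) * (a - c)
          * (a ^ 2 + b ^ 2 + c ^ 2 + a * b + b * c + a * c)) by ring]
      positivity
  have hsnd : ∑ i, t i * (x i).2 = 0 := by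
    simpa [Prod.snd_sum] using congrArg Prod.snd hsum
  have hterm := (Finset.sum_eq_zero_iff_of_nonneg
    fun i _ => mul_nonneg (ht i) (hpos i).le).1 hsnd
  have ht0 : ∀ i, t i = 0 := fun i =>
    (mul_eq_zero.1 (hterm i (Finset.mem_univ i))).resolve_right (hpos i).ne'
  simp [ht0, Prod.ext_iff] at hsum
end
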